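/- Let ρ > −1 and α ∈ (0,1). The Mainardi-Wright function ξ_α(θ) = ∑_{n=0}^∞ (−1)^n θ^n / (n! Γ(1−α(1+n))) satisfies the moment formula ∫₀^∞ θ^ρ ξ_α(θ) dθ = Γ(1+ρ)/Γ(1+αρ). -/

import Mathlib

open MeasureTheory Set Real

/-- The Mainardi–Wright function. -/
noncomputable def mainardiWright (α θ : ℝ) : ℝ :=
  ∑' n : ℕ, (-1) ^ n * θ ^ n / ((n.factorial : ℝ) * Real.Gamma (1 - α * (1 + n)))


lemma mw_rpow_bound {K t a r : ℝ} {N : ℕ} (hK : 1 ≤ K) (ht : 0 ≤ t) (ha0 : 0 ≤ a) (ha : a ≤ 1 + t)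
    (h : K⁻¹ ≤ a ∨ 0 ≤ r) (hr : |r| ≤ N) : a ^ r ≤ (K * (1 + t)) ^ N := by
  have h1 : 1 ≤ K * (1 + t) := by nlinarith
  have h2 : a ≤ K * (1 + t) := by nlinarith
  have hpos : 0 ≤ r → a ^ r ≤ (K * (1 + t)) ^ N := fun h0 => by
    calc a ^ r ≤ (K * (1 + t)) ^ r := Real.rpow_le_rpow ha0 h2 h0
      _ ≤ (K * (1 + t)) ^ (N : ℝ) := Real.rpow_le_rpow_of_exponent_le h1 ((le_abs_self r).trans hr)
      _ = _ := Real.rpow_natCast _ _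
  rcases le_total 0 r with h0 | h0
  · exact hpos h0
  rcases h with h | h
  · have hKp : 0 < K⁻¹ := by positivity
    calc a ^ r ≤ (K⁻¹) ^ r := Real.rpow_le_rpow_of_nonpos hKp h h0
      _ = K ^ (-r) := by rw [Real.inv_rpow (by positivity), Real.rpow_neg (by positivity)]
      _ ≤ (K * (1 + t)) ^ (-r) := Real.rpow_le_rpow (by positivity) (by nlinarith) (by linarith)
      _ ≤ (K * (1 + t)) ^ (N : ℝ) := Real.rpow_le_rpow_of_exponent_le h1 ((neg_le_abs r).trans hr)
      _ = _ := Real.rpow_natCast _ _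
  · exact hpos h

lemma mw_bound_isLittleO (K : ℝ) (N : ℕ) {k : ℝ} (hk : k < 0) :
    (fun t : ℝ => (K * (1 + t)) ^ N * (Real.exp 1 * Real.exp (t * k))) =o[Filter.atTop]
      fun t => Real.exp (-(-k / 2) * t) := by
  have h := (isLittleO_pow_exp_pos_mul_atTop N (b := -k / 2) (by linarith)).comp_tendsto
    (Filter.tendsto_atTop_add_const_left Filter.atTop (1 : ℝ) Filter.tendsto_id)
  have h2 := (h.const_mul_left (K ^ N * Real.exp 1)).mul_isBigO
    (Asymptotics.isBigO_refl (fun t : ℝ => Real.exp (t * k)) Filter.atTop)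
  have h3 : (fun x : ℝ => Real.exp (-k / 2 * (1 + x)) * Real.exp (x * k)) =
      fun x => Real.exp (-k / 2) * Real.exp (-(-k / 2) * x) := by
    funext x
    rw [← Real.exp_add, ← Real.exp_add]; congr 1; ring
  refine Asymptotics.IsLittleO.trans_isBigO (g := fun x : ℝ => Real.exp (-k / 2 * (1 + x)) * Real.exp (x * k)) ?_ ?_
  · refine h2.congr_left ?_
    intro x
    simp [mul_pow]; ring
  · rw [h3]
    exact (Asymptotics.isBigO_refl _ _).const_mul_left _

lemma mw_bound_integrable (K : ℝ) (N : ℕ) {k : ℝ} (hk : k < 0) :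
    IntegrableOn (fun t : ℝ => (K * (1 + t)) ^ N * (Real.exp 1 * Real.exp (t * k))) (Ioi 0) :=
  integrable_of_isBigO_exp_neg (b := -k / 2) (by linarith) (by fun_prop)
    (mw_bound_isLittleO K N hk).isBigO

lemma mw_bound_tendsto (K : ℝ) (N : ℕ) {k : ℝ} (hk : k < 0) :
    Filter.Tendsto (fun t : ℝ => (K * (1 + t)) ^ N * (Real.exp 1 * Real.exp (t * k)))
      Filter.atTop (nhds 0) := by
  have h := (mw_bound_isLittleO K N hk).isBigO
  refine h.trans_tendsto ?_
  refine Real.tendsto_exp_atBot.comp ?_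
  exact Filter.tendsto_id.const_mul_atTop_of_neg (by linarith)

lemma mw_norm_le {u : ℂ} (hu : ‖u‖ = 1) {x t : ℝ} (hx0 : 0 ≤ x) (hx : x ≤ 1) (ht : 0 ≤ t) :
    ‖(x : ℂ) + t * u‖ ≤ 1 + t := by
  calc ‖(x : ℂ) + t * u‖ ≤ ‖(x : ℂ)‖ + ‖(t : ℂ) * u‖ := norm_add_le _ _
    _ = x + t := by simp [hu, abs_of_nonneg hx0, abs_of_nonneg ht]
    _ ≤ _ := by linarith

lemma mw_le_norm {u : ℂ} (hu : ‖u‖ = 1) (t : ℝ) : u.im ≤ ‖(1 : ℂ) + t * u‖ := by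
  have h1 : ‖(1 : ℂ) + t * u‖ = ‖(1 + t * u) * (starRingEnd ℂ) u‖ := by simp [hu]
  have h2 := Complex.abs_im_le_norm ((1 + t * u) * (starRingEnd ℂ) u)
  have h3 : ((1 + t * u) * (starRingEnd ℂ) u).im = - u.im := by
    simp; ring
  rw [h1]
  rw [h3, abs_neg] at h2
  exact (le_abs_self _).trans h2

lemma mw_term_bound {u : ℂ} (hu : ‖u‖ = 1) {K x t r : ℝ} {N : ℕ} (hK : 1 ≤ K) (hx0 : 0 ≤ x)
    (hx : x ≤ 1) (ht : 0 ≤ t) (h : K⁻¹ ≤ ‖(x : ℂ) + t * u‖ ∨ 0 ≤ r) (hr : |r| ≤ N) :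
    ‖Complex.exp (x + t * u) * ((x : ℂ) + t * u) ^ (r : ℂ)‖ ≤
      (K * (1 + t)) ^ N * (Real.exp 1 * Real.exp (t * u.re)) := by
  rw [norm_mul, Complex.norm_cpow_real, Complex.norm_exp, mul_comm]
  have h1 := mw_rpow_bound hK ht (norm_nonneg _) (mw_norm_le hu hx0 hx ht) h hr
  have h2 : Real.exp ((x + t * u : ℂ)).re ≤ Real.exp 1 * Real.exp (t * u.re) := by
    rw [← Real.exp_add]
    apply Real.exp_le_exp.2
    simp; exact hx
  exact mul_le_mul h1 h2 (Real.exp_nonneg _) (by positivity)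

lemma mw_term_integrable {u : ℂ} (hu : ‖u‖ = 1) (hre : u.re < 0) {K x r : ℝ} (hK : 1 ≤ K)
    (hx0 : 0 ≤ x) (hx : x ≤ 1) (h : ∀ t : ℝ, 0 < t → K⁻¹ ≤ ‖(x : ℂ) + t * u‖ ∨ 0 ≤ r) :
    IntegrableOn (fun t : ℝ => Complex.exp (x + t * u) * ((x : ℂ) + t * u) ^ (r : ℂ) * u) (Ioi 0) := by
  obtain ⟨N, hN⟩ := exists_nat_ge |r|
  refine Integrable.mul_const ?_ u
  refine (mw_bound_integrable K N hre).mono' ?_ ?_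
  · apply Measurable.aestronglyMeasurable; fun_prop
  · refine (ae_restrict_iff' measurableSet_Ioi).2 (Filter.Eventually.of_forall fun t ht => ?_)
    exact mw_term_bound hu hK hx0 hx (le_of_lt ht) (h t ht) hN

lemma mw_mem_slit {u : ℂ} (him : 0 < u.im) {x t : ℝ} (hx : 0 ≤ x) (ht : 0 ≤ t) (h : 0 < x ∨ 0 < t) :
    (x : ℂ) + t * u ∈ Complex.slitPlane := by
  rcases ht.eq_or_lt with rfl | ht
  · left; simpa using h
  · right; simp; exact ⟨ht.ne', him.ne'⟩

lemma mw_hasDerivAt {r : ℝ} {s : ℂ} (hs : s ∈ Complex.slitPlane) :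
    HasDerivAt (fun s => Complex.exp s * s ^ (r : ℂ))
      (Complex.exp s * s ^ (r : ℂ) + r * (Complex.exp s * s ^ ((r - 1 : ℝ) : ℂ))) s := by
  have := (Complex.hasDerivAt_exp s).mul ((hasDerivAt_id s).cpow_const (c := (r : ℂ)) hs)
  refine this.congr_deriv ?_
  push_cast
  simp only [id, mul_one]
  ring

lemma mw_ftc {u : ℂ} (hu : ‖u‖ = 1) (hre : u.re < 0) (him : 0 < u.im) {K x r : ℝ} (hK : 1 ≤ K)
    (hx0 : 0 < x) (hx : x ≤ 1)
    (h : ∀ t : ℝ, 0 < t → K⁻¹ ≤ ‖(x : ℂ) + t * u‖ ∨ 0 ≤ r - 1) :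
    ∫ t in Ioi (0 : ℝ), (Complex.exp (x + t * u) * ((x : ℂ) + t * u) ^ (r : ℂ) * u +
      r * (Complex.exp (x + t * u) * ((x : ℂ) + t * u) ^ ((r - 1 : ℝ) : ℂ) * u)) =
      -((Real.exp x * x ^ r : ℝ) : ℂ) := by
  have h' : ∀ t : ℝ, 0 < t → K⁻¹ ≤ ‖(x : ℂ) + t * u‖ ∨ 0 ≤ r := fun t ht =>
    (h t ht).imp id (fun h => by linarith)
  have key := integral_Ioi_of_hasDerivAt_of_tendsto' (a := (0 : ℝ)) (m := (0 : ℂ))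
    (f := fun t : ℝ => Complex.exp (x + t * u) * ((x : ℂ) + t * u) ^ (r : ℂ))
    (f' := fun t : ℝ => (Complex.exp (x + t * u) * ((x : ℂ) + t * u) ^ (r : ℂ) * u +
      r * (Complex.exp (x + t * u) * ((x : ℂ) + t * u) ^ ((r - 1 : ℝ) : ℂ) * u))) ?_ ?_ ?_
  · rw [key]
    simp [Complex.ofReal_cpow hx0.le]
  · intro t ht
    have h1 := mw_hasDerivAt (r := r) (mw_mem_slit him hx0.le ht (Or.inl hx0))
    have h2 : HasDerivAt (fun t : ℝ => (x : ℂ) + t * u) u t := by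
      simpa using ((Complex.ofRealCLM.hasDerivAt (x := t)).mul_const u).const_add (x : ℂ)
    have h3 := h1.comp t h2
    refine h3.congr_deriv ?_
    ring
  · exact (mw_term_integrable hu hre hK hx0.le hx h').add
      ((mw_term_integrable hu hre hK hx0.le hx h).const_mul _)
  · obtain ⟨N, hN⟩ := exists_nat_ge |r|
    refine squeeze_zero_norm' ?_ (mw_bound_tendsto K N hre)
    filter_upwards [Filter.eventually_gt_atTop 0] with t ht
    exact mw_term_bound hu hK hx0.le hx ht.le (h' t ht) hN

lemma mw_rpow_exp_integrable {s b : ℝ} (hs : -1 < s) (hb : 0 < b) :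
    IntegrableOn (fun t : ℝ => t ^ s * Real.exp (-b * t)) (Ioi 0) := by
  simpa using integrableOn_rpow_mul_exp_neg_mul_rpow (p := 1) hs one_pos hb

lemma mw_gamma_differentiable {a : ℝ} (ha : 0 < a) :
    DifferentiableOn ℂ (fun w : ℂ => ∫ t in Ioi (0 : ℝ), ((t ^ (a - 1) : ℝ) : ℂ) * Complex.exp (-(w * t)))
      {w : ℂ | 0 < w.re} := by
  intro w hw
  have hw' : 0 < w.re := hw
  have hmem : {z : ℂ | w.re / 2 < z.re} ∈ nhds w :=
    (isOpen_lt continuous_const Complex.continuous_re).mem_nhds (by simp; linarith)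
  have key := hasDerivAt_integral_of_dominated_loc_of_deriv_le (μ := volume.restrict (Ioi (0 : ℝ)))
    (F := fun (w : ℂ) (t : ℝ) => ((t ^ (a - 1) : ℝ) : ℂ) * Complex.exp (-(w * t)))
    (F' := fun (w : ℂ) (t : ℝ) => ((t ^ (a - 1) : ℝ) : ℂ) * (Complex.exp (-(w * t)) * (-t)))
    (x₀ := w) (bound := fun t => t ^ a * Real.exp (-(w.re / 2) * t)) hmem ?_ ?_ ?_ ?_ ?_ ?_
  · exact key.2.differentiableAt.differentiableWithinAt
  · refine Filter.Eventually.of_forall fun z => ?_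
    apply Measurable.aestronglyMeasurable; fun_prop
  · refine (mw_rpow_exp_integrable (s := a - 1) (b := w.re) (by linarith) hw').mono' ?_ ?_
    · apply Measurable.aestronglyMeasurable; fun_prop
    · refine (ae_restrict_iff' measurableSet_Ioi).2 (Filter.Eventually.of_forall fun t ht => ?_)
      have ht : 0 < t := ht
      rw [norm_mul, Complex.norm_exp, Complex.norm_real, Real.norm_of_nonneg (by positivity)]
      simp
  · apply Measurable.aestronglyMeasurable; fun_prop
  · refine (ae_restrict_iff' measurableSet_Ioi).2 (Filter.Eventually.of_forall fun t ht z hz => ?_)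
    have ht : 0 < t := ht
    have hz : w.re / 2 < z.re := hz
    rw [norm_mul, norm_mul, Complex.norm_exp, Complex.norm_real, Real.norm_of_nonneg (by positivity)]
    have h1 : t ^ a = t ^ (a - 1) * t := by
      rw [Real.rpow_sub_one ht.ne']; field_simp
    have h2 : Real.exp (-(z * t)).re ≤ Real.exp (-(w.re / 2) * t) := by
      apply Real.exp_le_exp.2
      simp; nlinarith
    have h3 : ‖(-(t : ℂ))‖ = t := by simp [abs_of_pos ht]
    rw [h1, h3]
    calc t ^ (a - 1) * (Real.exp (-(z * t)).re * t) ≤ t ^ (a - 1) * (Real.exp (-(w.re / 2) * t) * t) := by gcongr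
      _ = _ := by ring
  · exact mw_rpow_exp_integrable (by linarith) (by linarith)
  · refine Filter.Eventually.of_forall fun t z _ => ?_
    have h1 : HasDerivAt (fun z : ℂ => -(z * t)) (-t) z := by
      exact ((hasDerivAt_id z).mul_const (t : ℂ)).neg.congr_deriv (by simp)
    exact (h1.cexp).const_mul _

lemma mw_gamma_integral {a : ℝ} (ha : 0 < a) {w : ℂ} (hw : 0 < w.re) :
    ∫ t in Ioi (0 : ℝ), ((t ^ (a - 1) : ℝ) : ℂ) * Complex.exp (-(w * t)) =
      Real.Gamma a * w ^ (-(a : ℂ)) := by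
  have hopen : IsOpen {w : ℂ | 0 < w.re} := isOpen_lt continuous_const Complex.continuous_re
  have h1 := (mw_gamma_differentiable ha).analyticOnNhd hopen
  have h2 : DifferentiableOn ℂ (fun w : ℂ => Real.Gamma a * w ^ (-(a : ℂ))) {w : ℂ | 0 < w.re} := by
    intro z hz
    apply DifferentiableAt.differentiableWithinAt
    exact (differentiableAt_id.cpow_const (Or.inl hz)).const_mul _
  have h2 := h2.analyticOnNhd hopen
  have hconn : IsPreconnected {w : ℂ | 0 < w.re} :=
    (convex_halfSpace_re_gt 0).isPreconnected
  refine h1.eqOn_of_preconnected_of_frequently_eq h2 hconn (z₀ := 1) (by simp) ?_ hw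
  have hreal : ∀ x : ℝ, 0 < x → ∫ t in Ioi (0 : ℝ), ((t ^ (a - 1) : ℝ) : ℂ) * Complex.exp (-((x : ℂ) * t)) =
      Real.Gamma a * (x : ℂ) ^ (-(a : ℂ)) := by
    intro x hx
    have := Real.integral_rpow_mul_exp_neg_mul_Ioi ha hx
    have h3 : ∀ t : ℝ, ((t ^ (a - 1) : ℝ) : ℂ) * Complex.exp (-((x : ℂ) * t)) =
      ((t ^ (a - 1) * Real.exp (-(x * t)) : ℝ) : ℂ) := by intro t; push_cast; rfl
    simp_rw [h3]
    rw [integral_complex_ofReal, this]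
    have h4 : (x : ℂ) ^ (-(a : ℂ)) = ((x ^ (-a) : ℝ) : ℂ) := by
      rw [Complex.ofReal_cpow hx.le]; simp
    rw [h4, one_div, Real.inv_rpow hx.le, ← Real.rpow_neg hx.le]
    push_cast; ring
  have ht : Filter.Tendsto (fun n : ℕ => (((1 + 1 / ((n : ℝ) + 1)) : ℝ) : ℂ)) Filter.atTop
      (nhdsWithin (1 : ℂ) {1}ᶜ) := by
    rw [tendsto_nhdsWithin_iff]
    constructor
    · have := (tendsto_one_div_add_atTop_nhds_zero_nat (𝕜 := ℝ)).const_add 1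
      have := (Complex.continuous_ofReal.tendsto _).comp this
      rw [add_zero, Complex.ofReal_one] at this
      exact this
    · refine Filter.Eventually.of_forall fun n => ?_
      simp only [mem_compl_iff, mem_singleton_iff]
      norm_cast
      have : 0 < 1 / ((n : ℝ) + 1) := by positivity
      push_cast
      linarith
  refine ht.frequently (Filter.Eventually.of_forall fun n => hreal _ (by positivity)).frequently

lemma mw_base_zero {u : ℂ} (hre : u.re < 0) (him : 0 < u.im) {r : ℝ} (hr : 1 ≤ r) :
    ∫ t in Ioi (0 : ℝ), Complex.exp (((0 : ℝ) : ℂ) + t * u) * (((0 : ℝ) : ℂ) + t * u) ^ (r : ℂ) * u =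
      Real.Gamma (r + 1) * Complex.exp ((π * (r + 1) : ℝ) * Complex.I) := by
  have hu0 : u ≠ 0 := by rintro rfl; simp at him
  have h1 : ∀ t ∈ Ioi (0 : ℝ), Complex.exp (((0 : ℝ) : ℂ) + t * u) * (((0 : ℝ) : ℂ) + t * u) ^ (r : ℂ) * u =
      ((t ^ ((r + 1) - 1) : ℝ) : ℂ) * Complex.exp (-(-u * t)) * (u ^ (r : ℂ) * u) := by
    intro t ht
    have ht : 0 < t := ht
    have ht' : (t : ℂ) ≠ 0 := by exact_mod_cast ht.ne'
    have h2 : ((t : ℂ) * u) ^ (r : ℂ) = ((t ^ r : ℝ) : ℂ) * u ^ (r : ℂ) := by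
      rw [Complex.ofReal_cpow ht.le, Complex.cpow_def_of_ne_zero (mul_ne_zero ht' hu0),
        Complex.log_ofReal_mul ht hu0, Complex.cpow_def_of_ne_zero ht',
        Complex.cpow_def_of_ne_zero hu0, ← Complex.exp_add, Complex.ofReal_log ht.le]
      congr 1; ring
    rw [Complex.ofReal_zero, zero_add, h2, add_sub_cancel_right]
    have : -(-u * t) = t * u := by ring
    rw [this]; ring
  rw [setIntegral_congr_fun measurableSet_Ioi h1, integral_mul_const,
    mw_gamma_integral (by linarith) (by simpa using hre), mul_assoc]
  congr 1
  have h3 : u ^ (r : ℂ) * u = u ^ ((r : ℂ) + 1) := by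
    rw [Complex.cpow_add _ _ hu0, Complex.cpow_one]
  have h4 : Complex.log (-u) = Complex.log u - π * Complex.I := by
    simp only [Complex.log, Complex.arg_neg_eq_arg_sub_pi_of_im_pos him, norm_neg]
    push_cast; ring
  rw [h3, Complex.cpow_def_of_ne_zero (neg_ne_zero.2 hu0), Complex.cpow_def_of_ne_zero hu0,
    ← Complex.exp_add, h4]
  congr 1
  push_cast; ring

lemma mw_base_diff {u : ℂ} (hu : ‖u‖ = 1) (hre : u.re < 0) (him : 0 < u.im) {r : ℝ} (hr : 1 ≤ r) :
    ∃ c : ℝ, (∫ t in Ioi (0 : ℝ), Complex.exp (((1 : ℝ) : ℂ) + t * u) * (((1 : ℝ) : ℂ) + t * u) ^ (r : ℂ) * u)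
     - (∫ t in Ioi (0 : ℝ), Complex.exp (((0 : ℝ) : ℂ) + t * u) * (((0 : ℝ) : ℂ) + t * u) ^ (r : ℂ) * u)
      = (c : ℂ) := by
  set D : ℝ → ℝ → ℂ := fun x t => Complex.exp (x + t * u) * ((x : ℂ) + t * u) ^ (r : ℂ) * u +
      r * (Complex.exp (x + t * u) * ((x : ℂ) + t * u) ^ ((r - 1 : ℝ) : ℂ) * u) with hD
  obtain ⟨N, hN⟩ := exists_nat_ge (max |r| |r - 1|)
  set B : ℝ → ℝ := fun t => (1 * (1 + t)) ^ N * (Real.exp 1 * Real.exp (t * u.re)) with hB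
  have hBint : IntegrableOn B (Ioi 0) := mw_bound_integrable 1 N hre
  have hDm : Measurable (Function.uncurry D) := by
    simp only [hD, Function.uncurry_def]; fun_prop
  have hDb : ∀ x ∈ Icc (0 : ℝ) 1, ∀ t ∈ Ioi (0 : ℝ), ‖D x t‖ ≤ (1 + |r|) * B t := by
    intro x hx t ht
    have e1 := mw_term_bound hu (K := 1) le_rfl hx.1 hx.2 (le_of_lt ht) (Or.inr (by linarith : 0 ≤ r))
      ((le_max_left _ _).trans hN)
    have e2 := mw_term_bound hu (K := 1) le_rfl hx.1 hx.2 (le_of_lt ht) (Or.inr (by linarith : 0 ≤ r - 1))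
      ((le_max_right _ _).trans hN)
    simp only [hD]
    refine (norm_add_le _ _).trans ?_
    rw [norm_mul _ u, norm_mul (r : ℂ), norm_mul _ u, hu, mul_one, mul_one, Complex.norm_real,
      Real.norm_eq_abs]
    have := mul_le_mul_of_nonneg_left e2 (abs_nonneg r)
    simp only [hB]
    linarith
  have hDint : Integrable (Function.uncurry D)
      ((volume.restrict (Set.uIoc (0 : ℝ) 1)).prod (volume.restrict (Ioi (0 : ℝ)))) := by
    have hb : Integrable (fun z : ℝ × ℝ => (fun _ => (1 + |r|)) z.1 * B z.2)
      ((volume.restrict (Set.uIoc (0 : ℝ) 1)).prod (volume.restrict (Ioi (0 : ℝ)))) := by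
      refine Integrable.mul_prod (f := fun _ : ℝ => (1 + |r|)) ?_ hBint
      rw [uIoc_of_le zero_le_one]
      exact integrable_const _
    refine hb.mono' hDm.aestronglyMeasurable ?_
    rw [Measure.prod_restrict]
    refine (ae_restrict_iff' (measurableSet_uIoc.prod measurableSet_Ioi)).2
      (Filter.Eventually.of_forall fun z hz => ?_)
    rw [uIoc_of_le zero_le_one] at hz
    exact hDb z.1 ⟨hz.1.1.le, hz.1.2⟩ z.2 hz.2
  have hswap := intervalIntegral_integral_swap hDint
  have hL : ∫ x in (0 : ℝ)..1, ∫ t in Ioi (0 : ℝ), D x t = ((∫ x in (0 : ℝ)..1, -(Real.exp x * x ^ r) : ℝ) : ℂ) := by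
    rw [← intervalIntegral.integral_ofReal]
    refine intervalIntegral.integral_congr_ae (Filter.Eventually.of_forall fun x hx => ?_)
    rw [uIoc_of_le zero_le_one] at hx
    rw [hD]
    simp only
    rw [mw_ftc hu hre him (K := 1) le_rfl hx.1 hx.2 (fun t _ => Or.inr (by linarith))]
    push_cast; rfl
  have hR : ∫ t in Ioi (0 : ℝ), (∫ x in (0 : ℝ)..1, D x t) =
     (∫ t in Ioi (0 : ℝ), Complex.exp (((1 : ℝ) : ℂ) + t * u) * (((1 : ℝ) : ℂ) + t * u) ^ (r : ℂ) * u)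
     - (∫ t in Ioi (0 : ℝ), Complex.exp (((0 : ℝ) : ℂ) + t * u) * (((0 : ℝ) : ℂ) + t * u) ^ (r : ℂ) * u) := by
    rw [← integral_sub
      (mw_term_integrable hu hre (K := 1) le_rfl zero_le_one le_rfl (fun t _ => Or.inr (by linarith)))
      (mw_term_integrable hu hre (K := 1) le_rfl le_rfl zero_le_one (fun t _ => Or.inr (by linarith)))]
    refine setIntegral_congr_fun measurableSet_Ioi fun t ht => ?_
    have ht : 0 < t := ht
    have hder : ∀ x ∈ Set.uIcc (0 : ℝ) 1, HasDerivAt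
        (fun x : ℝ => Complex.exp (x + t * u) * ((x : ℂ) + t * u) ^ (r : ℂ) * u) (D x t) x := by
      intro x hx
      rw [uIcc_of_le zero_le_one] at hx
      have h1 := mw_hasDerivAt (r := r) (mw_mem_slit him hx.1 ht.le (Or.inr ht))
      have h2 : HasDerivAt (fun x : ℝ => (x : ℂ) + t * u) 1 x := by
        simpa using (Complex.ofRealCLM.hasDerivAt (x := x)).add_const ((t : ℂ) * u)
      have h3 := (h1.comp x h2).mul_const u
      refine h3.congr_deriv ?_
      simp only [hD]; ring
    refine intervalIntegral.integral_eq_sub_of_hasDerivAt hder ?_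
    rw [intervalIntegrable_iff, uIoc_of_le zero_le_one]
    refine Measure.integrableOn_of_bounded (M := (1 + |r|) * B t) (by simp) ?_ ?_
    · exact (hDm.comp (measurable_id.prodMk measurable_const)).aestronglyMeasurable
    · refine (ae_restrict_iff' measurableSet_Ioc).2 (Filter.Eventually.of_forall fun x hx => ?_)
      exact hDb x ⟨hx.1.le, hx.2⟩ t ht
  exact ⟨_, by rw [← hR, ← hswap, hL]⟩

lemma mw_base {u : ℂ} (hu : ‖u‖ = 1) (hre : u.re < 0) (him : 0 < u.im) {r : ℝ} (hr : 1 ≤ r) :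
    (∫ t in Ioi (0 : ℝ), Complex.exp (((1 : ℝ) : ℂ) + t * u) * (((1 : ℝ) : ℂ) + t * u) ^ (r : ℂ) * u).im
      = π / Real.Gamma (-r) := by
  obtain ⟨c, hc⟩ := mw_base_diff hu hre him hr
  rw [sub_eq_iff_eq_add] at hc
  rw [hc, mw_base_zero hre him hr]
  have h1 : ((c : ℂ) + Real.Gamma (r + 1) * Complex.exp ((π * (r + 1) : ℝ) * Complex.I)).im =
      Real.Gamma (r + 1) * Real.sin (π * (r + 1)) := by
    rw [Complex.add_im, Complex.ofReal_im, zero_add, Complex.im_ofReal_mul,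
      Complex.exp_ofReal_mul_I_im]
  rw [h1]
  have h2 := Real.Gamma_mul_Gamma_one_sub (r + 1)
  rw [show 1 - (r + 1) = -r by ring] at h2
  have h3 : 0 < Real.Gamma (r + 1) := Real.Gamma_pos_of_pos (by linarith)
  by_cases hs : Real.sin (π * (r + 1)) = 0
  · rw [hs, div_zero] at h2
    rcases mul_eq_zero.1 h2 with h | h
    · exact absurd h h3.ne'
    · rw [h, hs]; simp
  · have h4 : Real.Gamma (-r) ≠ 0 := by
      intro h
      rw [h, mul_zero] at h2
      exact (div_ne_zero Real.pi_ne_zero hs) h2.symm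
    rw [eq_div_iff h4]
    rw [eq_div_iff hs] at h2
    linarith

noncomputable def mwJ (u : ℂ) (r : ℝ) : ℂ :=
  ∫ t in Ioi (0 : ℝ), Complex.exp (((1 : ℝ) : ℂ) + t * u) * (((1 : ℝ) : ℂ) + t * u) ^ (r : ℂ) * u

lemma mw_K {u : ℂ} (hu : ‖u‖ = 1) (him : 0 < u.im) : 1 ≤ (u.im)⁻¹ := by
  have h := (le_abs_self _).trans (Complex.abs_im_le_norm u)
  rw [hu] at h
  exact (one_le_inv₀ him).2 h

lemma mw_K_le {u : ℂ} (hu : ‖u‖ = 1) (t : ℝ) : ((u.im)⁻¹)⁻¹ ≤ ‖((1 : ℝ) : ℂ) + t * u‖ := by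
  rw [inv_inv]
  simpa using mw_le_norm hu t

lemma mwJ_rec {u : ℂ} (hu : ‖u‖ = 1) (hre : u.re < 0) (him : 0 < u.im) (r : ℝ) :
    (mwJ u r).im + r * (mwJ u (r - 1)).im = 0 := by
  have h := mw_ftc hu hre him (r := r) (mw_K hu him) one_pos le_rfl (fun t _ => Or.inl (mw_K_le hu t))
  rw [integral_add, integral_const_mul] at h
  · have h2 := congrArg Complex.im h
    rw [Complex.add_im, Complex.im_ofReal_mul, Complex.neg_im, Complex.ofReal_im, neg_zero] at h2
    exact h2
  · exact mw_term_integrable hu hre (mw_K hu him) zero_le_one le_rfl (fun t _ => Or.inl (mw_K_le hu t))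
  · exact (mw_term_integrable hu hre (mw_K hu him) zero_le_one le_rfl
      (fun t _ => Or.inl (mw_K_le hu t))).const_mul _

lemma mwJ_continuous {u : ℂ} (hu : ‖u‖ = 1) (hre : u.re < 0) (him : 0 < u.im) (r₀ : ℝ) :
    ContinuousAt (fun r => mwJ u r) r₀ := by
  obtain ⟨N, hN⟩ := exists_nat_gt |r₀|
  unfold mwJ
  refine continuousAt_of_dominated
    (bound := fun t => ((u.im)⁻¹ * (1 + t)) ^ N * (Real.exp 1 * Real.exp (t * u.re))) ?_ ?_
    (mw_bound_integrable _ N hre) ?_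
  · refine Filter.Eventually.of_forall fun r => ?_
    apply Measurable.aestronglyMeasurable; fun_prop
  · have : ∀ᶠ r : ℝ in nhds r₀, |r| < N := continuous_abs.continuousAt.eventually_lt_const hN
    filter_upwards [this] with r hr
    refine (ae_restrict_iff' measurableSet_Ioi).2 (Filter.Eventually.of_forall fun t ht => ?_)
    rw [norm_mul, hu, mul_one]
    exact mw_term_bound hu (mw_K hu him) zero_le_one le_rfl (le_of_lt ht) (Or.inl (mw_K_le hu t)) hr.le
  · refine (ae_restrict_iff' measurableSet_Ioi).2 (Filter.Eventually.of_forall fun t ht => ?_)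
    have hs := Complex.slitPlane_ne_zero
      (mw_mem_slit him (x := 1) zero_le_one (le_of_lt ht) (Or.inl one_pos))
    refine ContinuousAt.mul (ContinuousAt.mul continuousAt_const ?_) continuousAt_const
    exact ContinuousAt.const_cpow Complex.continuous_ofReal.continuousAt (Or.inl hs)

lemma mwJ_im {u : ℂ} (hu : ‖u‖ = 1) (hre : u.re < 0) (him : 0 < u.im) (z : ℝ) :
    (mwJ u (-z)).im = π / Real.Gamma z := by
  have base : ∀ z : ℝ, z ≤ -1 → (mwJ u (-z)).im = π / Real.Gamma z := fun z hz => by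
    have := mw_base hu hre him (r := -z) (by linarith)
    rw [neg_neg] at this
    exact this
  have step : ∀ z : ℝ, z - 1 ≠ 0 → (mwJ u (-(z - 1))).im = π / Real.Gamma (z - 1) →
      (mwJ u (-z)).im = π / Real.Gamma z := fun z hz h => by
    have h1 := mwJ_rec hu hre him (-(z - 1))
    rw [show -(z - 1) - 1 = -z by ring, h] at h1
    have h2 := Real.Gamma_add_one hz
    rw [sub_add_cancel] at h2
    rw [h2]
    have h3 : (mwJ u (-z)).im = (π / Real.Gamma (z - 1)) / (z - 1) := by
      rw [eq_div_iff hz]; linarith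
    rw [h3, div_div, mul_comm]
  have b0 : ∀ z : ℝ, z ≤ 0 → (mwJ u (-z)).im = π / Real.Gamma z := fun z hz =>
    step z (by linarith) (base _ (by linarith))
  have b1 : ∀ z : ℝ, z < 1 → (mwJ u (-z)).im = π / Real.Gamma z := fun z hz =>
    step z (by linarith) (b0 _ (by linarith))
  have one : (mwJ u (-1)).im = π / Real.Gamma 1 := by
    have c1 : ContinuousAt (fun z : ℝ => (mwJ u (-z)).im) 1 := by
      have := (mwJ_continuous hu hre him (-1))
      have h2 : ContinuousAt (fun z : ℝ => mwJ u (-z)) 1 :=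
        ContinuousAt.comp (f := fun z : ℝ => -z) (g := fun r => mwJ u r) this continuous_neg.continuousAt
      exact Complex.continuous_im.continuousAt.comp h2
    have c2 : ContinuousAt (fun z : ℝ => π / Real.Gamma z) 1 := by
      refine continuousAt_const.div (Real.differentiableAt_Gamma ?_).continuousAt (by simp)
      intro m h
      have : (0 : ℝ) ≤ m := Nat.cast_nonneg m
      linarith
    have t1 := c1.tendsto.mono_left (nhdsWithin_le_nhds (s := Iio (1 : ℝ)))
    have t2 := c2.tendsto.mono_left (nhdsWithin_le_nhds (s := Iio (1 : ℝ)))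
    refine tendsto_nhds_unique t1 (t2.congr' ?_)
    filter_upwards [self_mem_nhdsWithin] with z hz
    exact (b1 z hz).symm
  have all : ∀ n : ℕ, ∀ z : ℝ, z < n + 1 → (mwJ u (-z)).im = π / Real.Gamma z := by
    intro n
    induction n with
    | zero => intro z hz; exact b1 z (by simpa using hz)
    | succ n ih =>
      intro z hz
      push_cast at hz
      by_cases h : z - 1 = 0
      · have : z = 1 := by linarith
        rw [this]; exact one
      · exact step z h (ih _ (by linarith))
  obtain ⟨n, hn⟩ := exists_nat_gt z
  exact all n z (by linarith)

lemma mw_sublinear {α θ ε : ℝ} (hα0 : 0 < α) (hα1 : α < 1) (hθ : 0 ≤ θ) (hε : 0 < ε) :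
    ∃ C : ℝ, ∀ t : ℝ, 0 ≤ t → θ * (1 + t) ^ α ≤ C + ε * t := by
  have h1 : Filter.Tendsto (fun X : ℝ => θ * X ^ (-(1 - α))) Filter.atTop (nhds (θ * 0)) :=
    (tendsto_rpow_neg_atTop (by linarith)).const_mul θ
  rw [mul_zero] at h1
  obtain ⟨X, hX1, hX2⟩ := ((h1.eventually_lt_const hε).and (Filter.eventually_ge_atTop 1)).exists
  refine ⟨θ * X ^ α + ε, fun t ht => ?_⟩
  have hX0 : 0 < X := by linarith
  have hy : ∀ y : ℝ, 0 ≤ y → y ^ α ≤ 1 + y := by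
    intro y hy
    rcases le_total y 1 with h | h
    · have := Real.rpow_le_one hy h hα0.le
      linarith
    · have := Real.rpow_le_rpow_of_exponent_le h hα1.le
      rw [Real.rpow_one] at this
      linarith
  have h2 := hy ((1 + t) / X) (by positivity)
  rw [Real.div_rpow (by positivity) hX0.le, div_le_iff₀ (by positivity)] at h2
  have h3 : X ^ α = X ^ (-(1 - α)) * X := by
    rw [← Real.rpow_add_one hX0.ne']; congr 1; ring
  have h4 : (1 + (1 + t) / X) * X ^ α = X ^ α + X ^ (-(1 - α)) * (1 + t) := by
    rw [add_mul, one_mul]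
    congr 1
    rw [h3]; field_simp
  rw [h4] at h2
  have h5 := mul_le_mul_of_nonneg_left h2 hθ
  nlinarith

lemma mw_series {u : ℂ} (hu : ‖u‖ = 1) (hre : u.re < 0) (him : 0 < u.im) {α θ : ℝ}
    (hα0 : 0 < α) (hα1 : α < 1) (hθ : 0 ≤ θ) :
    mainardiWright α θ = π⁻¹ * (∫ t in Ioi (0 : ℝ), Complex.exp (((1 : ℝ) : ℂ) + t * u) *
      (((1 : ℝ) : ℂ) + t * u) ^ ((α - 1 : ℝ) : ℂ) * u *
      Complex.exp (-((((1 : ℝ) : ℂ) + t * u) ^ (α : ℂ) * θ))).im := by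
  have hK := mw_K hu him
  set K := (u.im)⁻¹ with hKdef
  set F : ℕ → ℝ → ℂ := fun n t => Complex.exp (((1 : ℝ) : ℂ) + t * u) *
      (((1 : ℝ) : ℂ) + t * u) ^ ((α - 1 + α * n : ℝ) : ℂ) * u * (((-θ) ^ n / n.factorial : ℝ) : ℂ) with hF
  set b : ℝ → ℝ := fun t => (K * (1 + t)) ^ 1 * (Real.exp 1 * Real.exp (t * u.re)) with hb
  have hs0 : ∀ t : ℝ, 0 < t → (((1 : ℝ) : ℂ) + t * u) ≠ 0 := fun t ht =>
    Complex.slitPlane_ne_zero (mw_mem_slit him zero_le_one ht.le (Or.inl one_pos))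
  have hpow : ∀ (n : ℕ) (t : ℝ), 0 < t → (((1 : ℝ) : ℂ) + t * u) ^ ((α - 1 + α * n : ℝ) : ℂ) =
      (((1 : ℝ) : ℂ) + t * u) ^ ((α - 1 : ℝ) : ℂ) * ((((1 : ℝ) : ℂ) + t * u) ^ (α : ℂ)) ^ n := by
    intro n t ht
    rw [Complex.ofReal_add, Complex.cpow_add _ _ (hs0 t ht)]
    congr 1
    rw [← Complex.cpow_mul_nat]
    push_cast; rfl
  have hsum : HasSum (fun n => ∫ t in Ioi (0 : ℝ), F n t)
      (∫ t in Ioi (0 : ℝ), Complex.exp (((1 : ℝ) : ℂ) + t * u) *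
      (((1 : ℝ) : ℂ) + t * u) ^ ((α - 1 : ℝ) : ℂ) * u *
      Complex.exp (-((((1 : ℝ) : ℂ) + t * u) ^ (α : ℂ) * θ))) := by
    have hbs : ∀ t : ℝ, HasSum (fun n : ℕ => b t * ((θ * (1 + t) ^ α) ^ n / n.factorial))
        (b t * Real.exp (θ * (1 + t) ^ α)) := by
      intro t
      have := NormedSpace.expSeries_div_hasSum_exp (𝔸 := ℝ) (θ * (1 + t) ^ α)
      rw [← Real.exp_eq_exp_ℝ] at this
      exact this.mul_left _
    refine hasSum_integral_of_dominated_convergence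
      (fun n t => b t * ((θ * (1 + t) ^ α) ^ n / n.factorial)) ?_ ?_ ?_ ?_ ?_
    · intro n
      apply Measurable.aestronglyMeasurable
      simp only [hF]; fun_prop
    · intro n
      refine (ae_restrict_iff' measurableSet_Ioi).2 (Filter.Eventually.of_forall fun t ht => ?_)
      have ht : 0 < t := ht
      simp only [hF]
      rw [hpow n t ht, norm_mul, norm_mul _ u, hu, mul_one, ← mul_assoc, norm_mul, norm_pow,
        Complex.norm_cpow_real, mul_assoc]
      have e1 := mw_term_bound hu (r := α - 1) (N := 1) hK zero_le_one le_rfl ht.le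
        (Or.inl (mw_K_le hu t)) (by rw [abs_le]; constructor <;> push_cast <;> linarith)
      have e2 := Real.rpow_le_rpow (norm_nonneg _) (mw_norm_le hu zero_le_one le_rfl ht.le) hα0.le
      have e3 := pow_le_pow_left₀ (by positivity) e2 n
      have e4 : ‖(((-θ) ^ n / n.factorial : ℝ) : ℂ)‖ = θ ^ n / n.factorial := by
        rw [Complex.norm_real, norm_div, norm_pow, norm_neg, Real.norm_of_nonneg hθ]; simp
      rw [e4]
      refine mul_le_mul e1 ?_ (by positivity) ((norm_nonneg _).trans e1)
      rw [mul_pow]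
      calc _ ≤ ((1 + t) ^ α) ^ n * (θ ^ n / n.factorial) := by gcongr
        _ = _ := by ring
    · exact Filter.Eventually.of_forall fun t => (hbs t).summable
    · simp_rw [fun t => (hbs t).tsum_eq]
      obtain ⟨C, hC⟩ := mw_sublinear hα0 hα1 hθ (ε := -u.re / 2) (by linarith)
      refine ((mw_bound_integrable K 1 (k := u.re / 2) (by linarith)).const_mul (Real.exp C)).mono' ?_ ?_
      · apply Measurable.aestronglyMeasurable
        simp only [hb]; fun_prop
      · refine (ae_restrict_iff' measurableSet_Ioi).2 (Filter.Eventually.of_forall fun t ht => ?_)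
        have ht : 0 < t := ht
        have hb0 : 0 ≤ b t := by simp only [hb]; positivity
        rw [Real.norm_of_nonneg (by positivity)]
        have h1 : Real.exp (θ * (1 + t) ^ α) ≤ Real.exp (C + -u.re / 2 * t) := Real.exp_le_exp.2 (hC t ht.le)
        have h2 : Real.exp (t * u.re) * Real.exp (C + -u.re / 2 * t) = Real.exp C * Real.exp (t * (u.re / 2)) := by
          rw [← Real.exp_add, ← Real.exp_add]; congr 1; ring
        calc b t * Real.exp (θ * (1 + t) ^ α) ≤ b t * Real.exp (C + -u.re / 2 * t) := by gcongr
          _ = (K * (1 + t)) ^ 1 * Real.exp 1 * (Real.exp (t * u.re) * Real.exp (C + -u.re / 2 * t)) := by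
            simp only [hb]; ring
          _ ≤ _ := by rw [h2]; apply le_of_eq; ring
    · refine (ae_restrict_iff' measurableSet_Ioi).2 (Filter.Eventually.of_forall fun t ht => ?_)
      have ht : 0 < t := ht
      have h1 := NormedSpace.expSeries_div_hasSum_exp (𝔸 := ℂ) (-((((1 : ℝ) : ℂ) + t * u) ^ (α : ℂ) * θ))
      rw [← Complex.exp_eq_exp_ℂ] at h1
      have h2 := h1.mul_left (Complex.exp (((1 : ℝ) : ℂ) + t * u) *
      (((1 : ℝ) : ℂ) + t * u) ^ ((α - 1 : ℝ) : ℂ) * u)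
      refine h2.congr_fun ?_
      intro n
      simp only [hF]
      rw [hpow n t ht, ← mul_neg, mul_pow]
      push_cast
      ring
  have him' := (Complex.hasSum_im hsum).mul_left π⁻¹
  unfold mainardiWright
  rw [← him'.tsum_eq]
  congr 1
  funext n
  simp only [hF]
  rw [integral_mul_const]
  have hJ := mwJ_im hu hre him (1 - α * (1 + n))
  rw [show -(1 - α * (1 + (n : ℝ))) = α - 1 + α * n by ring] at hJ
  unfold mwJ at hJ
  rw [mul_comm (integral _ _), Complex.im_ofReal_mul, hJ, neg_pow θ]
  have := Real.pi_ne_zero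
  field_simp

lemma mw_arg {ψ : ℝ} (h0 : 0 < ψ) (hπ : ψ < π) {t : ℝ} (ht : 0 ≤ t) :
    0 ≤ Complex.arg (((1 : ℝ) : ℂ) + t * Complex.exp (ψ * Complex.I)) ∧
      Complex.arg (((1 : ℝ) : ℂ) + t * Complex.exp (ψ * Complex.I)) ≤ ψ := by
  have hsin : 0 < Real.sin ψ := Real.sin_pos_of_pos_of_lt_pi h0 hπ
  set s := ((1 : ℝ) : ℂ) + t * Complex.exp (ψ * Complex.I) with hs
  have hre : s.re = 1 + t * Real.cos ψ := by simp [hs, Complex.exp_ofReal_mul_I_re]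
  have him : s.im = t * Real.sin ψ := by simp [hs, Complex.exp_ofReal_mul_I_im]
  have h1 : 0 ≤ Complex.arg s := by
    rw [Complex.arg_nonneg_iff, him]; positivity
  refine ⟨h1, ?_⟩
  by_contra hlt
  push Not at hlt
  have h2 : 0 < Real.sin (Complex.arg s - ψ) :=
    Real.sin_pos_of_pos_of_lt_pi (by linarith) (by linarith [Complex.arg_le_pi s])
  have h3 : ‖s‖ * Real.cos (Complex.arg s) = s.re := Complex.norm_mul_cos_arg s
  have h4 : ‖s‖ * Real.sin (Complex.arg s) = s.im := Complex.norm_mul_sin_arg s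
  have h5 : ‖s‖ * Real.sin (Complex.arg s - ψ) = - Real.sin ψ := by
    rw [Real.sin_sub, mul_sub, ← mul_assoc, ← mul_assoc, h3, h4, hre, him]; ring
  have h6 : 0 ≤ ‖s‖ * Real.sin (Complex.arg s - ψ) := by positivity
  linarith

theorem stmt13 (α ρ : ℝ) (hα0 : 0 < α) (hα1 : α < 1) (hρ : ρ > -1) :
    (∫ θ in Ioi (0:ℝ), θ ^ ρ * mainardiWright α θ)
      = Real.Gamma (1 + ρ) / Real.Gamma (1 + α * ρ) := by
  have hπ := Real.pi_pos
  obtain ⟨ψ, hψ1, hψ2, hψ3⟩ : ∃ ψ : ℝ, π / 2 < ψ ∧ ψ < π ∧ ψ * α < π / 2 := by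
    refine ⟨π / (1 + α), ?_, ?_, ?_⟩
    · rw [div_lt_div_iff₀ (by norm_num) (by linarith)]; nlinarith
    · rw [div_lt_iff₀ (by linarith)]; nlinarith
    · rw [div_mul_eq_mul_div, div_lt_div_iff₀ (by linarith) (by norm_num)]; nlinarith
  have hψ0 : 0 < ψ := by linarith
  set u : ℂ := Complex.exp (ψ * Complex.I) with hudef
  have hu : ‖u‖ = 1 := Complex.norm_exp_ofReal_mul_I ψ
  have hre : u.re < 0 := by
    rw [hudef, Complex.exp_ofReal_mul_I_re]
    exact Real.cos_neg_of_pi_div_two_lt_of_lt hψ1 (by linarith)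
  have him : 0 < u.im := by
    rw [hudef, Complex.exp_ofReal_mul_I_im]
    exact Real.sin_pos_of_pos_of_lt_pi hψ0 hψ2
  have hK := mw_K hu him
  have hs0 : ∀ t : ℝ, 0 < t → (((1 : ℝ) : ℂ) + t * u) ≠ 0 := fun t ht =>
    Complex.slitPlane_ne_zero (mw_mem_slit him zero_le_one ht.le (Or.inl one_pos))
  -- lower bound on the real part of `s ^ α`
  have hcos : 0 < Real.cos (ψ * α) :=
    Real.cos_pos_of_mem_Ioo ⟨by nlinarith, hψ3⟩
  set δ : ℝ := u.im ^ α * Real.cos (ψ * α) with hδ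
  have hδ0 : 0 < δ := by positivity
  have hpowre : ∀ t : ℝ, 0 < t → δ ≤ ((((1 : ℝ) : ℂ) + t * u) ^ (α : ℂ)).re := by
    intro t ht
    obtain ⟨a1, a2⟩ := mw_arg hψ0 hψ2 ht.le
    rw [Complex.cpow_ofReal_re]
    refine mul_le_mul ?_ ?_ hcos.le (by positivity)
    · refine Real.rpow_le_rpow him.le ?_ hα0.le
      simpa using mw_le_norm hu t
    · refine Real.cos_le_cos_of_nonneg_of_le_pi (by positivity) (by linarith) ?_
      exact mul_le_mul_of_nonneg_right a2 hα0.le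
  set A : ℝ → ℂ := fun t => Complex.exp (((1 : ℝ) : ℂ) + t * u) *
      (((1 : ℝ) : ℂ) + t * u) ^ ((α - 1 : ℝ) : ℂ) * u with hA
  set G : ℝ → ℝ → ℂ := fun θ t => A t * (((θ ^ ρ : ℝ) : ℂ) *
      Complex.exp (-((((1 : ℝ) : ℂ) + t * u) ^ (α : ℂ) * θ))) with hG
  have hAm : Measurable A := by simp only [hA]; fun_prop
  have hGm : Measurable (Function.uncurry G) := by
    simp only [hG, hA, Function.uncurry_def]; fun_prop
  have hAb : IntegrableOn A (Ioi 0) :=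
    mw_term_integrable hu hre hK zero_le_one le_rfl (fun t _ => Or.inl (mw_K_le hu t))
  have hGint : Integrable (Function.uncurry G)
      ((volume.restrict (Ioi (0 : ℝ))).prod (volume.restrict (Ioi (0 : ℝ)))) := by
    refine Integrable.mono' (Integrable.mul_prod (mw_rpow_exp_integrable hρ hδ0) hAb.norm)
      hGm.aestronglyMeasurable ?_
    rw [Measure.prod_restrict]
    refine (ae_restrict_iff' (measurableSet_Ioi.prod measurableSet_Ioi)).2
      (Filter.Eventually.of_forall fun z hz => ?_)
    obtain ⟨θ, t⟩ := z
    have hθ : 0 < θ := hz.1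
    have ht : 0 < t := hz.2
    simp only [Function.uncurry, hG]
    rw [norm_mul, norm_mul ((θ ^ ρ : ℝ) : ℂ), Complex.norm_real, Real.norm_of_nonneg (by positivity),
      Complex.norm_exp, mul_comm]
    have h1 : (-((((1 : ℝ) : ℂ) + t * u) ^ (α : ℂ) * θ)).re ≤ -δ * θ := by
      rw [Complex.neg_re, Complex.re_mul_ofReal]
      nlinarith [hpowre t ht]
    gcongr
  have h1 : ∀ θ ∈ Ioi (0 : ℝ), θ ^ ρ * mainardiWright α θ = π⁻¹ * (∫ t in Ioi (0 : ℝ), G θ t).im := by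
    intro θ hθ
    have hθ : 0 < θ := hθ
    rw [mw_series hu hre him hα0 hα1 hθ.le]
    have : ∀ t : ℝ, G θ t = ((θ ^ ρ : ℝ) : ℂ) * (A t *
        Complex.exp (-((((1 : ℝ) : ℂ) + t * u) ^ (α : ℂ) * θ))) := by
      intro t; simp only [hG]; ring
    simp_rw [this]
    rw [integral_const_mul, Complex.im_ofReal_mul]
    ring
  rw [setIntegral_congr_fun measurableSet_Ioi h1, integral_const_mul]
  have h2 : ∫ θ in Ioi (0 : ℝ), (∫ t in Ioi (0 : ℝ), G θ t).im =
      (∫ θ in Ioi (0 : ℝ), ∫ t in Ioi (0 : ℝ), G θ t).im :=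
    Complex.imCLM.integral_comp_comm hGint.integral_prod_left
  rw [h2, integral_integral_swap hGint]
  have h3 : ∀ t ∈ Ioi (0 : ℝ), ∫ θ in Ioi (0 : ℝ), G θ t =
      (Complex.exp (((1 : ℝ) : ℂ) + t * u) * (((1 : ℝ) : ℂ) + t * u) ^ ((-(1 + α * ρ) : ℝ) : ℂ) * u) *
        (Real.Gamma (1 + ρ) : ℂ) := by
    intro t ht
    have ht : 0 < t := ht
    obtain ⟨a1, a2⟩ := mw_arg hψ0 hψ2 ht.le
    simp only [hG]
    rw [integral_const_mul]
    have h4 := mw_gamma_integral (a := 1 + ρ) (by linarith) (lt_of_lt_of_le hδ0 (hpowre t ht))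
    rw [add_sub_cancel_left] at h4
    rw [h4]
    have hlog : (Complex.log (((1 : ℝ) : ℂ) + t * u) * (α : ℂ)).im =
        Complex.arg (((1 : ℝ) : ℂ) + t * u) * α := by
      rw [Complex.im_mul_ofReal, Complex.log_im]
    have h5 : ((((1 : ℝ) : ℂ) + t * u) ^ (α : ℂ)) ^ (-((1 + ρ : ℝ) : ℂ)) =
        (((1 : ℝ) : ℂ) + t * u) ^ ((-(α * (1 + ρ)) : ℝ) : ℂ) := by
      rw [← Complex.cpow_mul]
      · congr 1; push_cast; ring
      · rw [hlog]
        have : 0 ≤ Complex.arg (((1 : ℝ) : ℂ) + t * u) * α := mul_nonneg a1 hα0.le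
        linarith
      · rw [hlog]
        have := mul_le_mul_of_nonneg_right a2 hα0.le
        linarith
    have h6 : (((1 : ℝ) : ℂ) + t * u) ^ ((-(1 + α * ρ) : ℝ) : ℂ) =
        (((1 : ℝ) : ℂ) + t * u) ^ ((α - 1 : ℝ) : ℂ) *
        (((1 : ℝ) : ℂ) + t * u) ^ ((-(α * (1 + ρ)) : ℝ) : ℂ) := by
      rw [← Complex.cpow_add _ _ (hs0 t ht), ← Complex.ofReal_add]
      congr 2; ring
    rw [h5, h6]
    simp only [hA]
    ring
  rw [setIntegral_congr_fun measurableSet_Ioi h3, integral_mul_const]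
  have hJ := mwJ_im hu hre him (1 + α * ρ)
  unfold mwJ at hJ
  rw [Complex.im_mul_ofReal, hJ]
  field_simp
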